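/- Assume (A0), (A1), (A2), (A3) and (A5): (a⁺/a⁻)(log γ) e^{2(D+P)} [ (a⁺ log γ)/(a⁻ log α) · e^{4D+3P+ζ⁺} − 1 ] < 1, where α = liminf_{t→∞} p(t)/δ(t), γ = limsup_{t→∞} p(t)/δ(t), D = limsup_{t→∞} ∫_{t−τ}^t δ(s) ds, P = limsup_{t→∞} ∫_{t−τ}^t p(s) ds, and ζ⁺ = max_{1≤j≤m} limsup_{t→∞} ∫_{t−σ_j(t)}^t δ(s) ds. Then equation (*) is globally attractive: for any two positive solutions x₁ and x₂, lim_{t→∞} (x₁(t) − x₂(t)) = 0. -/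

import Mathlib

open Real Filter MeasureTheory Set
noncomputable section
/-- A positive (admissible) solution of the nonautonomous Nicholson equation (*)
`x'(t) = ∑ j, p j t * x (t - τd j t) * exp (-(a j t * x (t - σd j t))) - δ t * x t`,
considered for `t ≥ 0`, with nonnegative continuous initial data on `[-τ, 0)` and `x 0 > 0`. -/
def IsPosSol (m : ℕ) (p a : Fin m → ℝ → ℝ) (δ : ℝ → ℝ)
    (τd σd : Fin m → ℝ → ℝ) (τ : ℝ) (x : ℝ → ℝ) : Prop :=
  ContinuousOn x (Ici (-τ)) ∧
  (∀ θ ∈ Ico (-τ) (0:ℝ), 0 ≤ x θ) ∧ 0 < x 0 ∧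
  ∀ t ≥ (0:ℝ), HasDerivWithinAt x
      ((∑ j, p j t * x (t - τd j t) * Real.exp (-(a j t * x (t - σd j t)))) - δ t * x t)
      (Ici 0) t

/-- Hypothesis (A0): the coefficients `p j, a j, δ` are continuous and positive on `[0,∞)`;
the delays `τd j, σd j` are continuous, nonnegative and bounded; and each `a j` is bounded
below and above by positive constants. -/
def HypA0 (m : ℕ) (p a : Fin m → ℝ → ℝ) (δ : ℝ → ℝ)
    (τd σd : Fin m → ℝ → ℝ) : Prop :=
  (∀ j, ContinuousOn (p j) (Ici 0) ∧ ∀ t ≥ (0:ℝ), 0 < p j t) ∧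
  (∀ j, ContinuousOn (a j) (Ici 0) ∧
      ∃ c C : ℝ, 0 < c ∧ ∀ t ≥ (0:ℝ), c ≤ a j t ∧ a j t ≤ C) ∧
  (ContinuousOn δ (Ici 0) ∧ ∀ t ≥ (0:ℝ), 0 < δ t) ∧
  (∀ j, ContinuousOn (τd j) (Ici 0) ∧ ContinuousOn (σd j) (Ici 0) ∧
      (∀ t ≥ (0:ℝ), 0 ≤ τd j t ∧ 0 ≤ σd j t) ∧
      ∃ B : ℝ, ∀ t ≥ (0:ℝ), τd j t ≤ B ∧ σd j t ≤ B)

/-- `τ = max_j max (sup_t τd j t, sup_t σd j t)`: the supremum of all the delays. -/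
def IsMaxDelay (m : ℕ) (τd σd : Fin m → ℝ → ℝ) (τ : ℝ) : Prop :=
  IsLUB {r : ℝ | ∃ j : Fin m, ∃ t : ℝ, 0 ≤ t ∧ (r = τd j t ∨ r = σd j t)} τ

/-- Hypothesis (A1): `liminf_{t→∞} p(t)/δ(t) > 1` and `limsup_{t→∞} p(t)/δ(t) < ∞`. -/
def HypA1 (m : ℕ) (p : Fin m → ℝ → ℝ) (δ : ℝ → ℝ) : Prop :=
  1 < Filter.liminf (fun t => (∑ j, p j t) / δ t) Filter.atTop ∧
  Filter.IsBoundedUnder (· ≤ ·) Filter.atTop (fun t => (∑ j, p j t) / δ t)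

/-- Hypothesis (A2): `limsup_{t→∞} ∫_{t-τ}^t p(s) ds < ∞`. -/
def HypA2 (m : ℕ) (p : Fin m → ℝ → ℝ) (τ : ℝ) : Prop :=
  Filter.IsBoundedUnder (· ≤ ·) Filter.atTop (fun t => ∫ s in t - τ..t, (∑ j, p j s))

/-- Hypothesis (A3): `∫_0^∞ δ(s) ds = ∞`. -/
def HypA3 (δ : ℝ → ℝ) : Prop :=
  Filter.Tendsto (fun t => ∫ s in (0:ℝ)..t, δ s) Filter.atTop Filter.atTop

/-! ### Basic calculus tools -/

lemma nich_mono_of_deriv {f f' : ℝ → ℝ} {T : ℝ} (hf : ∀ t ≥ T, HasDerivAt f (f' t) t)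
    (hf' : ∀ t ≥ T, 0 ≤ f' t) {s t : ℝ} (hs : T ≤ s) (hst : s ≤ t) : f s ≤ f t := by
  have hm : MonotoneOn f (Ici T) := by
    apply monotoneOn_of_deriv_nonneg (convex_Ici T)
    · intro u hu
      exact (hf u hu).continuousAt.continuousWithinAt
    · intro u hu
      rw [interior_Ici] at hu
      exact (hf u (le_of_lt hu)).differentiableAt.differentiableWithinAt
    · intro u hu
      rw [interior_Ici] at hu
      rw [(hf u (le_of_lt hu)).deriv]
      exact hf' u (le_of_lt hu)
  exact hm hs (le_trans hs hst) hst

lemma nich_deriv_nonneg_of_left_max {f : ℝ → ℝ} {f' s t : ℝ} (hst : s < t)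
    (hf : HasDerivAt f f' t) (hmax : ∀ r ∈ Icc s t, f r ≤ f t) : 0 ≤ f' := by
  have h1 : Tendsto (slope f t) (nhdsWithin t (Iio t)) (nhds f') :=
    (hasDerivWithinAt_iff_tendsto_slope' (by simp)).1 (hf.hasDerivWithinAt (s := Iio t))
  refine ge_of_tendsto h1 ?_
  have h2 : ∀ᶠ r in nhdsWithin t (Iio t), r ∈ Ioo s t := Ioo_mem_nhdsLT hst
  filter_upwards [h2] with r hr
  rw [slope_def_field]
  apply div_nonneg_of_nonpos
  · linarith [hmax r ⟨hr.1.le, hr.2.le⟩]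
  · linarith [hr.2]

/-- Barrier lemma. -/
lemma nich_barrier {f f' Δ δ : ℝ → ℝ} {N c ε K : ℝ} (hε : 0 < ε)
    (hf : ∀ t ≥ N, HasDerivAt f (f' t) t)
    (hΔ : ∀ t ≥ N, HasDerivAt Δ (δ t) t) (hδ : ∀ t ≥ N, 0 < δ t)
    (hb : ∀ t ≥ N, c ≤ f t → f' t ≤ -(ε * δ t))
    (hK : ∀ t ≥ N, K ≤ f t)
    (htop : Tendsto Δ atTop atTop) : ∀ᶠ t in atTop, f t ≤ c := by
  by_cases h : ∃ t₁ ≥ N, f t₁ ≤ c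
  · obtain ⟨t₁, ht₁, hc⟩ := h
    filter_upwards [eventually_ge_atTop t₁] with t ht
    have := image_le_of_deriv_right_lt_deriv_boundary (f := f) (f' := f') (a := t₁) (b := t)
      (B := fun _ => c) (B' := fun _ => 0)
      (fun u hu => (hf u (le_trans ht₁ hu.1)).continuousAt.continuousWithinAt)
      (fun u hu => (hf u (le_trans ht₁ hu.1)).hasDerivWithinAt) hc
      (fun u => hasDerivAt_const u c)
      (fun u hu hu2 => by
        have h1 := hb u (le_trans ht₁ hu.1) (le_of_eq hu2.symm)
        have h2 := mul_pos hε (hδ u (le_trans ht₁ hu.1))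
        linarith)
    exact this ⟨ht, le_rfl⟩
  · push Not at h
    exfalso
    have hmono : ∀ t ≥ N, -(f N + ε * Δ N) ≤ -(f t + ε * Δ t) := by
      intro t ht
      refine nich_mono_of_deriv (f := fun t => -(f t + ε * Δ t))
        (f' := fun t => -(f' t + ε * δ t)) (T := N) ?_ ?_ le_rfl ht
      · intro u hu
        exact ((hf u hu).add ((hΔ u hu).const_mul ε)).neg
      · intro u hu
        have := hb u hu (h u hu).le
        linarith
    obtain ⟨t, ht1, ht2⟩ := ((htop.eventually_gt_atTop ((f N + ε * Δ N - K) / ε)).and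
      (eventually_ge_atTop N)).exists
    have h1 := hmono t ht2
    have h2 := hK t ht2
    rw [div_lt_iff₀ hε] at ht1
    linarith

/-! ### The abstract setting -/

/-- The production term of the equation. -/
def nichN (m : ℕ) (p a : Fin m → ℝ → ℝ) (τd σd : Fin m → ℝ → ℝ) (x : ℝ → ℝ) (t : ℝ) : ℝ :=
  ∑ j, p j t * x (t - τd j t) * Real.exp (-(a j t * x (t - σd j t)))

/-- Coefficient bounds valid from time `T` on. -/
structure NichGood (m : ℕ) (p a : Fin m → ℝ → ℝ) (δ : ℝ → ℝ) (τd σd : Fin m → ℝ → ℝ) (τ : ℝ)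
    (Δ Q : ℝ → ℝ) (α γ D P ζ am ap T : ℝ) : Prop where
  hτ : 0 ≤ τ
  am_pos : 0 < am
  ap_pos : 0 < ap
  one_lt : 1 < α
  γ_pos : 0 < γ
  D0 : 0 ≤ D
  P0 : 0 ≤ P
  p_pos : ∀ t ≥ T, ∀ j, 0 < p j t
  δ_pos : ∀ t ≥ T, 0 < δ t
  low : ∀ t ≥ T, α * δ t ≤ ∑ j, p j t
  up : ∀ t ≥ T, ∑ j, p j t ≤ γ * δ t
  dΔ : ∀ t ≥ T, HasDerivAt Δ (δ t) t
  dQ : ∀ t ≥ T, HasDerivAt Q (∑ j, p j t) t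
  monΔ : ∀ s t, T ≤ s → s ≤ t → Δ s ≤ Δ t
  monQ : ∀ s t, T ≤ s → s ≤ t → Q s ≤ Q t
  bD : ∀ t ≥ T, ∀ s, t - τ ≤ s → s ≤ t → Δ t - Δ s ≤ D
  bP : ∀ t ≥ T, ∀ s, t - τ ≤ s → s ≤ t → Q t - Q s ≤ P
  bζ : ∀ t ≥ T, ∀ j, Δ t - Δ (t - σd j t) ≤ ζ
  ha : ∀ t ≥ T, ∀ j, am ≤ a j t ∧ a j t ≤ ap
  hτd : ∀ t ≥ T, ∀ j, 0 ≤ τd j t ∧ τd j t ≤ τ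
  hσd : ∀ t ≥ T, ∀ j, 0 ≤ σd j t ∧ σd j t ≤ τ
  htop : Tendsto Δ atTop atTop

/-- Positive solution from time `T` on. -/
structure NichSol (m : ℕ) (p a : Fin m → ℝ → ℝ) (δ : ℝ → ℝ) (τd σd : Fin m → ℝ → ℝ) (τ : ℝ)
    (T : ℝ) (x : ℝ → ℝ) : Prop where
  pos : ∀ t ≥ T - τ, 0 < x t
  der : ∀ t ≥ T, HasDerivAt x (nichN m p a τd σd x t - δ t * x t) t

section core

variable {m : ℕ} {p a : Fin m → ℝ → ℝ} {δ : ℝ → ℝ} {τd σd : Fin m → ℝ → ℝ} {τ : ℝ}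
    {Δ Q : ℝ → ℝ} {α γ D P ζ am ap T : ℝ} {x y : ℝ → ℝ}

lemma NichGood.N_le (G : NichGood m p a δ τd σd τ Δ Q α γ D P ζ am ap T)
    {t C w : ℝ} (ht : T ≤ t) (hC : ∀ j, x (t - τd j t) ≤ C) (hC0 : 0 ≤ C)
    (hw : ∀ j, w ≤ a j t * x (t - σd j t)) :
    nichN m p a τd σd x t ≤ (∑ j, p j t) * (C * Real.exp (-w)) := by
  unfold nichN
  rw [Finset.sum_mul]
  apply Finset.sum_le_sum
  intro j _
  have h1 := (G.p_pos t ht j).le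
  rw [mul_assoc]
  apply mul_le_mul_of_nonneg_left _ h1
  apply mul_le_mul (hC j) _ (Real.exp_pos _).le hC0
  apply Real.exp_le_exp.2
  linarith [hw j]

lemma NichGood.le_N (G : NichGood m p a δ τd σd τ Δ Q α γ D P ζ am ap T)
    {t C w : ℝ} (ht : T ≤ t) (hC : ∀ j, C ≤ x (t - τd j t)) (hC0 : 0 ≤ C)
    (hw : ∀ j, a j t * x (t - σd j t) ≤ w) :
    (∑ j, p j t) * (C * Real.exp (-w)) ≤ nichN m p a τd σd x t := by
  unfold nichN
  rw [Finset.sum_mul]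
  apply Finset.sum_le_sum
  intro j _
  have h1 := (G.p_pos t ht j).le
  rw [mul_assoc]
  apply mul_le_mul_of_nonneg_left _ h1
  apply mul_le_mul (hC j) _ (Real.exp_pos _).le (hC0.trans (hC j))
  apply Real.exp_le_exp.2
  linarith [hw j]

lemma NichGood.N_nonneg (G : NichGood m p a δ τd σd τ Δ Q α γ D P ζ am ap T)
    (S : NichSol m p a δ τd σd τ T x) {t : ℝ} (ht : T ≤ t) :
    0 ≤ nichN m p a τd σd x t := by
  unfold nichN
  apply Finset.sum_nonneg
  intro j _
  have h1 := (G.p_pos t ht j).le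
  have h2 := (S.pos (t - τd j t) (by linarith [(G.hτd t ht j).2])).le
  positivity

lemma NichGood.derX (G : NichGood m p a δ τd σd τ Δ Q α γ D P ζ am ap T)
    (S : NichSol m p a δ τd σd τ T x) {t : ℝ} (ht : T ≤ t) :
    HasDerivAt (fun t => x t * Real.exp (Δ t))
      (nichN m p a τd σd x t * Real.exp (Δ t)) t := by
  have h : HasDerivAt (fun t => x t * Real.exp (Δ t))
      ((nichN m p a τd σd x t - δ t * x t) * Real.exp (Δ t)
        + x t * (Real.exp (Δ t) * δ t)) t := (S.der t ht).mul (G.dΔ t ht).exp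
  have e : nichN m p a τd σd x t * Real.exp (Δ t)
      = (nichN m p a τd σd x t - δ t * x t) * Real.exp (Δ t)
        + x t * (Real.exp (Δ t) * δ t) := by ring
  rw [e]
  exact h

lemma NichGood.monX (G : NichGood m p a δ τd σd τ Δ Q α γ D P ζ am ap T)
    (S : NichSol m p a δ τd σd τ T x) {s t : ℝ} (hs : T ≤ s) (hst : s ≤ t) :
    x s * Real.exp (Δ s) ≤ x t * Real.exp (Δ t) := by
  refine nich_mono_of_deriv (f := fun t => x t * Real.exp (Δ t)) (T := T)
    (fun t ht => G.derX S ht) ?_ hs hst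
  intro t ht
  exact mul_nonneg (G.N_nonneg S ht) (Real.exp_pos _).le

lemma NichGood.back_gen (G : NichGood m p a δ τd σd τ Δ Q α γ D P ζ am ap T)
    (S : NichSol m p a δ τd σd τ T x) {s t C : ℝ} (hs : T ≤ s) (hst : s ≤ t)
    (hC : Δ t - Δ s ≤ C) :
    x s ≤ Real.exp C * x t := by
  have h1 := G.monX S hs hst
  have hx := S.pos t (by linarith [G.hτ])
  have h2 : x s = x s * Real.exp (Δ s) * Real.exp (-Δ s) := by
    rw [mul_assoc, ← Real.exp_add]; simp
  calc x s = x s * Real.exp (Δ s) * Real.exp (-Δ s) := h2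
    _ ≤ x t * Real.exp (Δ t) * Real.exp (-Δ s) :=
        mul_le_mul_of_nonneg_right h1 (Real.exp_pos _).le
    _ = x t * Real.exp (Δ t - Δ s) := by
        rw [mul_assoc, ← Real.exp_add]; ring_nf
    _ ≤ x t * Real.exp C := by
        apply mul_le_mul_of_nonneg_left _ hx.le
        exact Real.exp_le_exp.2 hC
    _ = _ := by ring

lemma NichGood.back (G : NichGood m p a δ τd σd τ Δ Q α γ D P ζ am ap T)
    (S : NichSol m p a δ τd σd τ T x) {s t : ℝ} (hs : T ≤ s) (hst : s ≤ t)
    (hts : t - τ ≤ s) : x s ≤ Real.exp D * x t :=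
  G.back_gen S hs hst (G.bD t (hs.trans hst) s hts hst)

lemma NichGood.forward (G : NichGood m p a δ τd σd τ Δ Q α γ D P ζ am ap T)
    (S : NichSol m p a δ τd σd τ T x) {s t : ℝ} (hs : T + τ ≤ s) (hst : s ≤ t)
    (hts : t - τ ≤ s) : x t ≤ Real.exp (D + P) * x s := by
  have hτ := G.hτ
  have hTs : T ≤ s := by linarith
  have hd : ∀ r ≥ T, HasDerivAt (fun r => x r * Real.exp (-Q r))
      ((nichN m p a τd σd x r - δ r * x r) * Real.exp (-Q r)
        + x r * (Real.exp (-Q r) * (-(∑ j, p j r)))) r := by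
    intro r hr
    exact (S.der r hr).mul ((G.dQ r hr).neg).exp
  obtain ⟨r, hr, hmax⟩ := (isCompact_Icc (a := s) (b := t)).exists_isMaxOn
    ⟨s, le_rfl, hst⟩ (f := fun r => x r * Real.exp (-Q r))
    (fun u hu => (hd u (hTs.trans hu.1)).continuousAt.continuousWithinAt)
  have hmax' : ∀ u ∈ Icc s t, x u * Real.exp (-Q u) ≤ x r * Real.exp (-Q r) := hmax
  have hTr : T ≤ r := hTs.trans hr.1
  have hxs := S.pos s (by linarith)
  have hxr := S.pos r (by linarith)
  have hDe : 1 ≤ Real.exp D := Real.one_le_exp G.D0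
  have key : x r ≤ Real.exp D * x s := by
    rcases eq_or_lt_of_le hr.1 with h | h
    · rw [← h]; nlinarith
    · by_contra hcon
      push Not at hcon
      have h0 := nich_deriv_nonneg_of_left_max h (hd r hTr)
        (fun u hu => hmax' u ⟨hu.1, hu.2.trans hr.2⟩)
      have h1 : nichN m p a τd σd x r ≤ (∑ j, p j r) * (x r * Real.exp (-0)) := by
        apply G.N_le hTr _ hxr.le
        · intro j
          have h2 := S.pos (r - σd j r) (by linarith [(G.hσd r hTr j).2])
          have h3 := (G.ha r hTr j).1
          have := G.am_pos
          have : 0 < a j r := by linarith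
          positivity
        · intro j
          have hτj := G.hτd r hTr j
          rcases le_total s (r - τd j r) with h4 | h4
          · have h5 := hmax' (r - τd j r) ⟨h4, by linarith [hr.2]⟩
            have h6 := G.monQ (r - τd j r) r (by linarith) (by linarith)
            have h7 : Real.exp (-Q r) ≤ Real.exp (-Q (r - τd j r)) :=
              Real.exp_le_exp.2 (by linarith)
            have h8 := Real.exp_pos (-Q (r - τd j r))
            by_contra h9
            push Not at h9
            nlinarith
          · have h5 := G.back S (s := r - τd j r) (t := s) (by linarith [hr.1]) h4
              (by linarith)
            linarith
      have h2 := Real.exp_pos (-Q r)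
      have h3 := mul_pos (G.δ_pos r hTr) hxr
      rw [neg_zero, Real.exp_zero, mul_one] at h1
      have h4 : 0 ≤ (nichN m p a τd σd x r - δ r * x r - x r * (∑ j, p j r))
          * Real.exp (-Q r) := by linarith
      have h5 := nonneg_of_mul_nonneg_left h4 h2
      linarith
  have h1 := hmax' t ⟨hst, le_rfl⟩
  have h2 : x t = x t * Real.exp (-Q t) * Real.exp (Q t) := by
    rw [mul_assoc, ← Real.exp_add]; simp
  calc x t = x t * Real.exp (-Q t) * Real.exp (Q t) := h2
    _ ≤ x r * Real.exp (-Q r) * Real.exp (Q t) :=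
        mul_le_mul_of_nonneg_right h1 (Real.exp_pos _).le
    _ = x r * Real.exp (Q t - Q r) := by
        rw [mul_assoc, ← Real.exp_add]; ring_nf
    _ ≤ (Real.exp D * x s) * Real.exp P := by
        apply mul_le_mul key _ (Real.exp_pos _).le (by positivity)
        exact Real.exp_le_exp.2 (G.bP t (by linarith) r (by linarith [hr.1]) hr.2)
    _ = _ := by rw [Real.exp_add]; ring

lemma NichGood.sigma_low (G : NichGood m p a δ τd σd τ Δ Q α γ D P ζ am ap T)
    (S : NichSol m p a δ τd σd τ T x) {t : ℝ} (ht : T + 2 * τ ≤ t) (j : Fin m) :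
    am * Real.exp (-(D + P)) * x t ≤ a j t * x (t - σd j t) := by
  have hτ := G.hτ
  have hT : T ≤ t := by linarith
  have hs := G.hσd t hT j
  have h1 := G.forward S (s := t - σd j t) (t := t) (by linarith) (by linarith) (by linarith)
  have h2 : Real.exp (-(D + P)) * x t ≤ x (t - σd j t) := by
    calc Real.exp (-(D + P)) * x t
        ≤ Real.exp (-(D + P)) * (Real.exp (D + P) * x (t - σd j t)) :=
          mul_le_mul_of_nonneg_left h1 (Real.exp_pos _).le
      _ = x (t - σd j t) := by
          rw [← mul_assoc, ← Real.exp_add]; simp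
  rw [mul_assoc]
  have h3 := S.pos t (by linarith)
  have := (G.ha t hT j).1
  have := G.am_pos
  exact mul_le_mul (by linarith) h2 (by positivity) (by linarith)

lemma NichGood.bounded (G : NichGood m p a δ τd σd τ Δ Q α γ D P ζ am ap T)
    (S : NichSol m p a δ τd σd τ T x) : ∃ c, ∀ᶠ t in atTop, x t ≤ c := by
  set β := am * Real.exp (-(D + P)) with hβ
  have hβ0 : 0 < β := mul_pos G.am_pos (Real.exp_pos _)
  have hlim : Tendsto (fun c : ℝ => γ * Real.exp D * Real.exp (-(β * c))) atTop
      (nhds (γ * Real.exp D * 0)) := by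
    apply Tendsto.const_mul
    exact Real.tendsto_exp_neg_atTop_nhds_zero.comp (tendsto_id.const_mul_atTop hβ0)
  rw [mul_zero] at hlim
  obtain ⟨c, hc1, hc2⟩ := ((hlim.eventually_lt_const (show (0:ℝ) < 1 / 2 by norm_num)).and
    (eventually_gt_atTop 0)).exists
  refine ⟨c, ?_⟩
  have hτ := G.hτ
  refine nich_barrier (N := T + 2 * τ) (ε := c / 2) (K := 0) (by positivity)
    (fun t ht => S.der t (by linarith)) (fun t ht => G.dΔ t (by linarith))
    (fun t ht => G.δ_pos t (by linarith)) ?_ (fun t ht => (S.pos t (by linarith)).le) G.htop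
  intro t ht hct
  have hT : T ≤ t := by linarith
  have hx := S.pos t (by linarith)
  have h1 : nichN m p a τd σd x t
      ≤ (∑ j, p j t) * ((Real.exp D * x t) * Real.exp (-(β * x t))) := by
    apply G.N_le hT _ (by positivity)
    · intro j; exact G.sigma_low S ht j
    · intro j
      have := G.hτd t hT j
      exact G.back S (by linarith) (by linarith) (by linarith)
  have hδ := G.δ_pos t hT
  have h2 : (∑ j, p j t) * ((Real.exp D * x t) * Real.exp (-(β * x t)))
      ≤ (γ * δ t) * ((Real.exp D * x t) * Real.exp (-(β * c))) := by
    apply mul_le_mul (G.up t hT) _ (by positivity) (mul_nonneg G.γ_pos.le hδ.le)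
    apply mul_le_mul_of_nonneg_left _ (by positivity)
    apply Real.exp_le_exp.2
    nlinarith
  have h3 : (γ * δ t) * ((Real.exp D * x t) * Real.exp (-(β * c)))
      = (γ * Real.exp D * Real.exp (-(β * c))) * (δ t * x t) := by ring
  have h4 : (γ * Real.exp D * Real.exp (-(β * c))) * (δ t * x t) ≤ 1 / 2 * (δ t * x t) :=
    mul_le_mul_of_nonneg_right hc1.le (by positivity)
  nlinarith

lemma NichGood.upper (G : NichGood m p a δ τd σd τ Δ Q α γ D P ζ am ap T)
    (S : NichSol m p a δ τd σd τ T x) {M : ℝ} (hM : 0 < M)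
    (hγ : γ * Real.exp (-(am * Real.exp (-(D + P)) * M)) < 1) :
    ∀ᶠ t in atTop, x t ≤ M := by
  set β := am * Real.exp (-(D + P)) with hβ
  have hβ0 : 0 < β := mul_pos G.am_pos (Real.exp_pos _)
  have hτ := G.hτ
  set A : Set ℝ := {c | M ≤ c ∧ ∀ᶠ t in atTop, x t ≤ c} with hA
  obtain ⟨c0, hc0⟩ := G.bounded S
  have hne : A.Nonempty := ⟨max c0 M, le_max_right _ _,
    hc0.mono (fun t ht => ht.trans (le_max_left _ _))⟩
  have hbd : BddBelow A := ⟨M, fun c hc => hc.1⟩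
  set L := sInf A with hL
  have hML : M ≤ L := le_csInf hne (fun c hc => hc.1)
  have hcont : ContinuousAt (fun ε : ℝ =>
      γ * (L + ε) * Real.exp (-(β * (L - ε))) - (L - ε) + ε) 0 := by fun_prop
  have h0 : γ * (L + 0) * Real.exp (-(β * (L - 0))) - (L - 0) + 0 < 0 := by
    have : Real.exp (-(β * L)) ≤ Real.exp (-(β * M)) := Real.exp_le_exp.2 (by nlinarith)
    have h1 : γ * Real.exp (-(β * L)) < 1 :=
      lt_of_le_of_lt (mul_le_mul_of_nonneg_left this G.γ_pos.le) hγ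
    have hL0 : 0 < L := by linarith
    simp only [add_zero, sub_zero]
    nlinarith
  have hev := hcont.eventually_lt_const (u := 0) h0
  obtain ⟨ε, hε2, hε⟩ : ∃ ε : ℝ, (γ * (L + ε) * Real.exp (-(β * (L - ε))) - (L - ε) + ε < 0)
      ∧ 0 < ε := ((hev.filter_mono nhdsWithin_le_nhds).and
        (self_mem_nhdsWithin (s := Ioi (0:ℝ)))).exists
  have hup : ∀ᶠ t in atTop, x t ≤ L + ε := by
    obtain ⟨c, hc, hcL⟩ := exists_lt_of_csInf_lt hne (show sInf A < L + ε by linarith)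
    exact hc.2.mono (fun t ht => by linarith)
  obtain ⟨N, hN⟩ := eventually_atTop.1 hup
  have hfin : ∀ᶠ t in atTop, x t ≤ L - ε := by
    have hN1 : ∀ t ≥ max (T + 2 * τ) (N + τ), T + 2 * τ ≤ t ∧ N + τ ≤ t := fun t ht =>
      ⟨(le_max_left _ _).trans ht, (le_max_right _ _).trans ht⟩
    refine nich_barrier (N := max (T + 2 * τ) (N + τ)) (ε := ε) (K := 0) hε
      (fun t ht => S.der t (by linarith [(hN1 t ht).1]))
      (fun t ht => G.dΔ t (by linarith [(hN1 t ht).1]))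
      (fun t ht => G.δ_pos t (by linarith [(hN1 t ht).1])) ?_
      (fun t ht => (S.pos t (by linarith [(hN1 t ht).1])).le) G.htop
    intro t ht' hct
    obtain ⟨ht, htN⟩ := hN1 t ht'
    have hT : T ≤ t := by linarith
    have hx := S.pos t (by linarith)
    have hδ := G.δ_pos t hT
    have h1 : nichN m p a τd σd x t ≤ (∑ j, p j t) * ((L + ε) * Real.exp (-(β * x t))) := by
      apply G.N_le hT _ (by linarith)
      · intro j; exact G.sigma_low S ht j
      · intro j
        have := G.hτd t hT j
        exact hN _ (by linarith)
    have h2 : (∑ j, p j t) * ((L + ε) * Real.exp (-(β * x t)))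
        ≤ (γ * δ t) * ((L + ε) * Real.exp (-(β * (L - ε)))) := by
      have hLe : 0 ≤ L + ε := by linarith
      apply mul_le_mul (G.up t hT) _ (by positivity) (mul_nonneg G.γ_pos.le hδ.le)
      apply mul_le_mul_of_nonneg_left _ hLe
      apply Real.exp_le_exp.2
      nlinarith
    nlinarith
  rcases le_total M (L - ε) with h | h
  · have : sInf A ≤ L - ε := csInf_le hbd ⟨h, hfin⟩
    linarith
  · exact hfin.mono (fun t ht => ht.trans h)

lemma NichGood.persist (G : NichGood m p a δ τd σd τ Δ Q α γ D P ζ am ap T)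
    (S : NichSol m p a δ τd σd τ T x) : ∃ k > 0, ∀ᶠ t in atTop, k ≤ x t := by
  have hτ := G.hτ
  have hα := G.one_lt
  have hcx : ∀ t ≥ T, ContinuousAt x t := fun t ht => (S.der t ht).continuousAt
  obtain ⟨r0, hr0, hmin0⟩ := (isCompact_Icc (a := T) (b := T + τ)).exists_isMinOn
    ⟨T, le_rfl, by linarith⟩ (f := x) (fun u hu => (hcx u hu.1).continuousWithinAt)
  have hcont : ContinuousAt (fun k : ℝ => α * Real.exp (-(ap * Real.exp D * k))) 0 := by fun_prop
  have hev := hcont.eventually_const_lt (u := 1) (by simpa using hα)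
  obtain ⟨k1, hk1, hk1pos⟩ : ∃ k : ℝ, 1 < α * Real.exp (-(ap * Real.exp D * k)) ∧ 0 < k :=
    ((hev.filter_mono nhdsWithin_le_nhds).and (self_mem_nhdsWithin (s := Ioi (0:ℝ)))).exists
  refine ⟨min k1 (x r0), lt_min hk1pos (S.pos r0 (by linarith [hr0.1])), ?_⟩
  filter_upwards [eventually_ge_atTop T] with t ht
  by_contra hcon
  push Not at hcon
  obtain ⟨r, hr, hmin⟩ := (isCompact_Icc (a := T) (b := t)).exists_isMinOn
    ⟨T, le_rfl, ht⟩ (f := x) (fun u hu => (hcx u hu.1).continuousWithinAt)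
  have hmin' : ∀ u ∈ Icc T t, x r ≤ x u := hmin
  have hrt : x r < min k1 (x r0) := lt_of_le_of_lt (hmin' t ⟨ht, le_rfl⟩) hcon
  have hr1 : T + τ < r := by
    by_contra h
    push Not at h
    have : x r0 ≤ x r := hmin0 (a := r) ⟨hr.1, h⟩
    linarith [min_le_right k1 (x r0)]
  have hT : T ≤ r := hr.1
  have hder := nich_deriv_nonneg_of_left_max (s := T) (by linarith) (S.der r hT).neg
    (fun u hu => by simpa using hmin' u ⟨hu.1, hu.2.trans hr.2⟩)
  have hx := S.pos r (by linarith)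
  have hδ := G.δ_pos r hT
  have h1 : (∑ j, p j r) * (x r * Real.exp (-(ap * Real.exp D * k1)))
      ≤ nichN m p a τd σd x r := by
    apply G.le_N hT _ hx.le
    · intro j
      have hs := G.hσd r hT j
      have h2 := G.back S (s := r - σd j r) (t := r) (by linarith) (by linarith) (by linarith)
      have h3 : x r ≤ k1 := hrt.le.trans (min_le_left _ _)
      have h4 := G.ha r hT j
      have h5 := S.pos (r - σd j r) (by linarith)
      rw [mul_assoc]
      apply mul_le_mul h4.2 _ h5.le G.ap_pos.le
      exact h2.trans (mul_le_mul_of_nonneg_left h3 (Real.exp_pos _).le)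
    · intro j
      have hs := G.hτd r hT j
      exact hmin' _ ⟨by linarith, by linarith [hr.2]⟩
  have h2 : (α * δ r) * (x r * Real.exp (-(ap * Real.exp D * k1)))
      ≤ (∑ j, p j r) * (x r * Real.exp (-(ap * Real.exp D * k1))) :=
    mul_le_mul_of_nonneg_right (G.low r hT) (by positivity)
  have h3 : (δ r * x r) * 1 < (δ r * x r) * (α * Real.exp (-(ap * Real.exp D * k1))) :=
    mul_lt_mul_of_pos_left hk1 (by positivity)
  nlinarith

lemma NichGood.lower (G : NichGood m p a δ τd σd τ Δ Q α γ D P ζ am ap T)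
    (S : NichSol m p a δ τd σd τ T x) {μ : ℝ} (hμ : 0 < μ)
    (hα : 1 < α * Real.exp (-(ap * Real.exp ζ * μ))) :
    ∀ᶠ t in atTop, μ ≤ x t := by
  set β := ap * Real.exp ζ with hβ
  have hβ0 : 0 < β := mul_pos G.ap_pos (Real.exp_pos _)
  have hτ := G.hτ
  have hα1 := G.one_lt
  set A : Set ℝ := {c | c ≤ μ ∧ ∀ᶠ t in atTop, c ≤ x t} with hA
  obtain ⟨k, hk, hkx⟩ := G.persist S
  obtain ⟨c0, hc0⟩ := G.bounded S
  have hkA : min k μ ∈ A := ⟨min_le_right _ _,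
    hkx.mono (fun t ht => (min_le_left _ _).trans ht)⟩
  have hne : A.Nonempty := ⟨_, hkA⟩
  have hbd : BddAbove A := ⟨μ, fun c hc => hc.1⟩
  set L := sSup A with hL
  have hLμ : L ≤ μ := csSup_le hne (fun c hc => hc.1)
  have hL0 : 0 < L := lt_of_lt_of_le (lt_min hk hμ) (le_csSup hbd hkA)
  have hcont : ContinuousAt (fun ε : ℝ =>
      α * (L - ε) * Real.exp (-(β * (L + ε))) - (L + ε) - ε) 0 := by fun_prop
  have h0 : 0 < α * (L - 0) * Real.exp (-(β * (L + 0))) - (L + 0) - 0 := by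
    have : Real.exp (-(β * μ)) ≤ Real.exp (-(β * L)) := Real.exp_le_exp.2 (by nlinarith)
    have h1 : 1 < α * Real.exp (-(β * L)) :=
      lt_of_lt_of_le hα (mul_le_mul_of_nonneg_left this (by linarith))
    simp only [add_zero, sub_zero]
    nlinarith
  have hev := hcont.eventually_const_lt (u := 0) h0
  obtain ⟨ε, ⟨hε2, hεL⟩, hε⟩ : ∃ ε : ℝ,
      ((0 < α * (L - ε) * Real.exp (-(β * (L + ε))) - (L + ε) - ε) ∧ ε < L)
      ∧ 0 < ε := (((hev.and (eventually_lt_nhds hL0)).filter_mono nhdsWithin_le_nhds).and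
        (self_mem_nhdsWithin (s := Ioi (0:ℝ)))).exists
  have hup : ∀ᶠ t in atTop, L - ε ≤ x t := by
    obtain ⟨c, hc, hcL⟩ := exists_lt_of_lt_csSup hne (show L - ε < sSup A by linarith)
    exact hc.2.mono (fun t ht => by linarith)
  obtain ⟨N, hN⟩ := eventually_atTop.1 (hup.and hc0)
  have hfin : ∀ᶠ t in atTop, -x t ≤ -(L + ε) := by
    have hN1 : ∀ t ≥ max (T + 2 * τ) (N + τ), T + 2 * τ ≤ t ∧ N + τ ≤ t := fun t ht =>
      ⟨(le_max_left _ _).trans ht, (le_max_right _ _).trans ht⟩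
    refine nich_barrier (f := fun t => -x t)
      (f' := fun t => -(nichN m p a τd σd x t - δ t * x t))
      (N := max (T + 2 * τ) (N + τ)) (ε := ε) (K := -c0) hε
      (fun t ht => (S.der t (by linarith [(hN1 t ht).1])).neg)
      (fun t ht => G.dΔ t (by linarith [(hN1 t ht).1]))
      (fun t ht => G.δ_pos t (by linarith [(hN1 t ht).1])) ?_
      (fun t ht => by linarith [(hN t (by linarith [(hN1 t ht).2])).2]) G.htop
    intro t ht' hct
    obtain ⟨ht, htN⟩ := hN1 t ht'
    have hT : T ≤ t := by linarith
    have hx := S.pos t (by linarith)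
    have hδ := G.δ_pos t hT
    have hLe : 0 ≤ L - ε := by linarith
    have h1 : (∑ j, p j t) * ((L - ε) * Real.exp (-(β * (L + ε))))
        ≤ nichN m p a τd σd x t := by
      apply G.le_N hT _ hLe
      · intro j
        have hs := G.hσd t hT j
        have h2 := G.back_gen S (s := t - σd j t) (t := t) (by linarith) (by linarith)
          (G.bζ t hT j)
        have h5 := S.pos (t - σd j t) (by linarith)
        rw [hβ, mul_assoc]
        apply mul_le_mul (G.ha t hT j).2 _ h5.le G.ap_pos.le
        exact h2.trans (mul_le_mul_of_nonneg_left (by linarith) (Real.exp_pos _).le)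
      · intro j
        have := G.hτd t hT j
        exact (hN _ (by linarith)).1
    have h2 : (α * δ t) * ((L - ε) * Real.exp (-(β * (L + ε))))
        ≤ (∑ j, p j t) * ((L - ε) * Real.exp (-(β * (L + ε)))) :=
      mul_le_mul_of_nonneg_right (G.low t hT) (by positivity)
    nlinarith
  rcases le_total (L + ε) μ with h | h
  · have : L + ε ≤ sSup A := le_csSup hbd ⟨h, hfin.mono (fun t ht => by linarith)⟩
    linarith
  · exact hfin.mono (fun t ht => by linarith)

set_option maxHeartbeats 1000000 in
lemma NichGood.contract (G : NichGood m p a δ τd σd τ Δ Q α γ D P ζ am ap T)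
    (Sx : NichSol m p a δ τd σd τ T x) (Sy : NichSol m p a δ τd σd τ T y)
    {V M μ : ℝ} (hV : 1 < V) (hμ : 0 < μ)
    (hyM : ∀ᶠ t in atTop, y t ≤ M) (hyμ : ∀ᶠ t in atTop, μ ≤ y t)
    (hcond : (Real.exp (2 * D + P) - 1) * (Real.exp (ap * M * (1 - 1 / V)) - 1) < 1 - 1 / V)
    (hxy : ∀ c > V, ∀ᶠ t in atTop, x t ≤ c * y t ∧ y t ≤ c * x t) :
    ∃ ε > 0, ∀ᶠ t in atTop, x t ≤ (V - ε) * y t := by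
  have hτ := G.hτ
  set E := Real.exp (2 * D + P) with hE
  have hD0 := G.D0
  have hP0 := G.P0
  have hE1 : 1 ≤ E := Real.one_le_exp (by linarith)
  set W := ap * M with hW
  set w := am * μ with hw
  have hw0 : 0 < w := mul_pos G.am_pos hμ
  have hV0 : V ≠ 0 := by linarith
  obtain ⟨tm, htm1, htm2⟩ := (hyM.and hyμ).exists
  have hM0 : 0 < M := by linarith
  have hW0 : 0 < W := mul_pos G.ap_pos hM0
  have hcG : ContinuousAt (fun ε : ℝ => (V + ε) * Real.exp (W * (1 - 1 / (V + ε)))) 0 := by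
    have : ContinuousAt (fun ε : ℝ => 1 / (V + ε)) 0 := by
      apply ContinuousAt.div (by fun_prop) (by fun_prop)
      simpa using hV0
    fun_prop
  have hch : ContinuousAt (fun ε : ℝ =>
      (V - ε - (V + ε) * Real.exp (W * (1 - 1 / (V + ε)))) * E
        + (V + ε) * Real.exp (W * (1 - 1 / (V + ε))) - 1) 0 := by
    fun_prop
  have h0 : 0 < (V - 0 - (V + 0) * Real.exp (W * (1 - 1 / (V + 0)))) * E
        + (V + 0) * Real.exp (W * (1 - 1 / (V + 0))) - 1 := by
    simp only [add_zero, sub_zero]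
    have : (V - V * Real.exp (W * (1 - 1 / V))) * E + V * Real.exp (W * (1 - 1 / V)) - 1
        = V * ((1 - 1 / V) - (E - 1) * (Real.exp (W * (1 - 1 / V)) - 1)) := by
      field_simp
      ring
    rw [this]
    apply mul_pos (by linarith)
    linarith
  have hev1 := hch.eventually_const_lt (u := 0) h0
  have hc2 : ContinuousAt (fun ε : ℝ => (V + ε) * Real.exp (-(w *
      ((V - ε - (V + ε) * Real.exp (W * (1 - 1 / (V + ε)))) * E
        + (V + ε) * Real.exp (W * (1 - 1 / (V + ε))) - 1))) - (V - ε) + ε) 0 := by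
    fun_prop
  have h02 : (V + 0) * Real.exp (-(w *
      ((V - 0 - (V + 0) * Real.exp (W * (1 - 1 / (V + 0)))) * E
        + (V + 0) * Real.exp (W * (1 - 1 / (V + 0))) - 1))) - (V - 0) + 0 < 0 := by
    have h1 := mul_pos hw0 h0
    have h2 := Real.exp_lt_one_iff.2 (neg_lt_zero.2 h1)
    have h3 := mul_lt_mul_of_pos_left h2 (show 0 < V + 0 by linarith)
    linarith
  have hev2 := hc2.eventually_lt_const (u := 0) h02
  obtain ⟨ε, ⟨hh, hε2⟩, hε'⟩ := (((hev1.and hev2).filter_mono nhdsWithin_le_nhds).and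
        (self_mem_nhdsWithin (s := Ioi (0:ℝ)))).exists
  have hε : 0 < ε := hε'
  set Γ := (V + ε) * Real.exp (W * (1 - 1 / (V + ε))) with hΓ
  set h := (V - ε - Γ) * E + Γ - 1 with hhdef
  refine ⟨ε, hε, ?_⟩
  have hVe : 1 < V + ε := by linarith
  have hVe1 : 0 ≤ 1 - 1 / (V + ε) := by
    rw [sub_nonneg, div_le_one (by linarith)]; linarith
  have hΓ1 : V + ε ≤ Γ := by
    have := Real.one_le_exp (mul_nonneg hW0.le hVe1)
    rw [hΓ]
    nlinarith
  obtain ⟨N0, hN0⟩ := eventually_atTop.1 ((hyM.and hyμ).and (hxy (V + ε) (by linarith)))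
  obtain ⟨N, hN, hNT⟩ : ∃ N, (∀ t ≥ N, (y t ≤ M ∧ μ ≤ y t) ∧
      x t ≤ (V + ε) * y t ∧ y t ≤ (V + ε) * x t) ∧ T + 2 * τ ≤ N :=
    ⟨max N0 (T + 2 * τ), fun t ht => hN0 t ((le_max_left _ _).trans ht), le_max_right _ _⟩
  -- the monotone combination
  have hmono : ∀ s t, N + τ ≤ s → s ≤ t →
      Γ * (y s * Real.exp (Δ s)) - x s * Real.exp (Δ s)
        ≤ Γ * (y t * Real.exp (Δ t)) - x t * Real.exp (Δ t) := by
    intro s t hs hst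
    refine nich_mono_of_deriv (T := N + τ)
      (f := fun t => Γ * (y t * Real.exp (Δ t)) - x t * Real.exp (Δ t))
      (f' := fun t => Γ * (nichN m p a τd σd y t * Real.exp (Δ t))
        - nichN m p a τd σd x t * Real.exp (Δ t)) ?_ ?_ hs hst
    · intro u hu
      exact ((G.derX Sy (by linarith)).const_mul Γ).sub (G.derX Sx (by linarith))
    · intro u hu
      have hT : T ≤ u := by linarith
      have hle : nichN m p a τd σd x u ≤ Γ * nichN m p a τd σd y u := by
        unfold nichN
        rw [Finset.mul_sum]
        apply Finset.sum_le_sum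
        intro j _
        have hpj := (G.p_pos u hT j).le
        have hτj := G.hτd u hT j
        have hσj := G.hσd u hT j
        have haj := G.ha u hT j
        have ham := G.am_pos
        have hA := hN (u - τd j u) (by linarith)
        have hB := hN (u - σd j u) (by linarith)
        have e1 : Γ * (p j u * y (u - τd j u) * Real.exp (-(a j u * y (u - σd j u))))
            = p j u * (((V + ε) * y (u - τd j u)) *
              Real.exp (W * (1 - 1 / (V + ε)) + -(a j u * y (u - σd j u)))) := by
          rw [Real.exp_add, hΓ]; ring
        rw [e1, mul_assoc]
        apply mul_le_mul_of_nonneg_left _ hpj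
        apply mul_le_mul hA.2.1 _ (Real.exp_pos _).le
          (mul_nonneg (by linarith) (by linarith [hA.1.2]))
        apply Real.exp_le_exp.2
        have h1 : y (u - σd j u) / (V + ε) ≤ x (u - σd j u) := by
          rw [div_le_iff₀ (by linarith)]
          linarith [hB.2.2]
        have h2 : a j u * (y (u - σd j u) / (V + ε)) ≤ a j u * x (u - σd j u) :=
          mul_le_mul_of_nonneg_left h1 (by linarith)
        have h3 : a j u * y (u - σd j u) ≤ W :=
          mul_le_mul haj.2 hB.1.1 (by linarith [hB.1.2]) G.ap_pos.le
        have h4 := mul_le_mul_of_nonneg_right h3 hVe1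
        have h5 : a j u * y (u - σd j u) * (1 - 1 / (V + ε))
            = a j u * y (u - σd j u) - a j u * (y (u - σd j u) / (V + ε)) := by ring
        linarith
      have := mul_le_mul_of_nonneg_right hle (Real.exp_pos (Δ u)).le
      linarith
  have hlowv : ∀ s t, N + τ ≤ s → s ≤ t → t - τ ≤ s → (V - ε) * y t ≤ x t →
      (1 + h) * y s ≤ x s := by
    intro s t hs hst hts hv
    have h1 := hmono s t hs hst
    have h2 := G.forward Sy (s := s) (t := t) (by linarith) hst hts
    have h3 : Real.exp (Δ t) ≤ Real.exp D * Real.exp (Δ s) := by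
      rw [← Real.exp_add]
      apply Real.exp_le_exp.2
      linarith [G.bD t (by linarith) s hts hst]
    have hys := Sy.pos s (by linarith)
    have h4 : y t * Real.exp (Δ t) ≤ E * (y s * Real.exp (Δ s)) := by
      calc y t * Real.exp (Δ t)
          ≤ (Real.exp (D + P) * y s) * (Real.exp D * Real.exp (Δ s)) :=
            mul_le_mul h2 h3 (Real.exp_pos _).le (by positivity)
        _ = (Real.exp (D + P) * Real.exp D) * (y s * Real.exp (Δ s)) := by ring
        _ = E * (y s * Real.exp (Δ s)) := by
            rw [← Real.exp_add, hE]; ring_nf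
    have h5 := mul_le_mul_of_nonneg_right hv (Real.exp_pos (Δ t)).le
    have h6 := mul_le_mul_of_nonneg_left h4 (show 0 ≤ Γ - (V - ε) by linarith)
    have h7 : (1 + h) * y s * Real.exp (Δ s) ≤ x s * Real.exp (Δ s) := by
      have : (1 + h) * y s * Real.exp (Δ s) = Γ * (y s * Real.exp (Δ s))
          - (Γ - (V - ε)) * (E * (y s * Real.exp (Δ s))) := by
        rw [hhdef]; ring
      rw [this]
      linarith
    exact le_of_mul_le_mul_right h7 (Real.exp_pos _)
  -- barrier
  set β := μ * Real.exp (-W) / M with hβ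
  have hβ0 : 0 < β := by positivity
  have hfin : ∀ᶠ t in atTop, x t / y t ≤ V - ε := by
    refine nich_barrier (N := N + 2 * τ) (ε := ε * β) (K := 0) (f := fun t => x t / y t)
      (f' := fun t => ((nichN m p a τd σd x t - δ t * x t) * y t
        - x t * (nichN m p a τd σd y t - δ t * y t)) / (y t) ^ 2)
      (Δ := Δ) (δ := δ) (by positivity) ?_
      (fun t ht => G.dΔ t (by linarith)) (fun t ht => G.δ_pos t (by linarith)) ?_ ?_ G.htop
    · intro t ht
      exact (Sx.der t (by linarith)).div (Sy.der t (by linarith))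
        (Sy.pos t (by linarith)).ne'
    · intro t ht hct
      have hT : T ≤ t := by linarith
      have hyt := Sy.pos t (by linarith)
      have hδ := G.δ_pos t hT
      have hNt := hN t (by linarith)
      have hv : (V - ε) * y t ≤ x t := by
        rwa [le_div_iff₀ hyt] at hct
      have hNx : nichN m p a τd σd x t
          ≤ (V + ε) * Real.exp (-(w * h)) * nichN m p a τd σd y t := by
        unfold nichN
        rw [Finset.mul_sum]
        apply Finset.sum_le_sum
        intro j _
        have hpj := (G.p_pos t hT j).le
        have hτj := G.hτd t hT j
        have hσj := G.hσd t hT j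
        have haj := G.ha t hT j
        have ham := G.am_pos
        have hA := hN (t - τd j t) (by linarith)
        have hB := hN (t - σd j t) (by linarith)
        have e1 : (V + ε) * Real.exp (-(w * h)) *
              (p j t * y (t - τd j t) * Real.exp (-(a j t * y (t - σd j t))))
            = p j t * (((V + ε) * y (t - τd j t)) *
              Real.exp (-(w * h) + -(a j t * y (t - σd j t)))) := by
          rw [Real.exp_add]; ring
        rw [e1, mul_assoc]
        apply mul_le_mul_of_nonneg_left _ hpj
        apply mul_le_mul hA.2.1 _ (Real.exp_pos _).le
          (mul_nonneg (by linarith) (by linarith [hA.1.2]))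
        apply Real.exp_le_exp.2
        have h1 := hlowv (t - σd j t) t (by linarith) (by linarith) (by linarith) hv
        have h2 := mul_le_mul_of_nonneg_left h1 (show 0 ≤ a j t by linarith)
        have h3 : w ≤ a j t * y (t - σd j t) :=
          mul_le_mul haj.1 hB.1.2 hμ.le (by linarith)
        have h4 := mul_le_mul_of_nonneg_right h3 hh.le
        linarith
      have hNy : β * δ t * y t ≤ nichN m p a τd σd y t := by
        have h1 : (∑ j, p j t) * (μ * Real.exp (-W)) ≤ nichN m p a τd σd y t := by
          apply G.le_N hT _ hμ.le
          · intro j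
            have hσj := G.hσd t hT j
            have hB := hN (t - σd j t) (by linarith)
            exact mul_le_mul (G.ha t hT j).2 hB.1.1 (by linarith [hB.1.2]) G.ap_pos.le
          · intro j
            have hτj := G.hτd t hT j
            exact (hN (t - τd j t) (by linarith)).1.2
        have h2 : δ t ≤ ∑ j, p j t := by
          have := G.low t hT
          have := G.one_lt
          nlinarith
        have h3 := mul_le_mul_of_nonneg_right h2 (show 0 ≤ μ * Real.exp (-W) by positivity)
        have h4 : β * δ t * y t ≤ β * δ t * M :=
          mul_le_mul_of_nonneg_left hNt.1.1 (by positivity)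
        have h5 : β * δ t * M = δ t * (μ * Real.exp (-W)) := by
          rw [hβ]; field_simp
        linarith
      have hNy0 : 0 ≤ nichN m p a τd σd y t := G.N_nonneg Sy hT
      rw [div_le_iff₀ (by positivity)]
      have h1 := mul_le_mul_of_nonneg_right hNx hyt.le
      have h2 := mul_le_mul_of_nonneg_right hv hNy0
      have h3 : (V + ε) * Real.exp (-(w * h)) ≤ V - ε - ε := by linarith
      have h4 := mul_le_mul_of_nonneg_right h3 (mul_nonneg hNy0 hyt.le)
      have h5 := mul_le_mul_of_nonneg_right hNy (mul_nonneg hε.le hyt.le)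
      linarith
    · intro t ht
      exact div_nonneg (Sx.pos t (by linarith)).le (Sy.pos t (by linarith)).le
  filter_upwards [hfin, eventually_ge_atTop T] with t ht htT
  rwa [div_le_iff₀ (Sy.pos t (by linarith))] at ht

lemma nich_cond {W ρ E V : ℝ} (hW : 0 < W) (hE : 1 ≤ E) (hV : 1 < V) (hVρ : V ≤ ρ)
    (h : W * (ρ * E - 1) < 1) :
    (E - 1) * (Real.exp (W * (1 - 1 / V)) - 1) < 1 - 1 / V := by
  have hφ0 : 0 < 1 - 1 / V := by
    rw [sub_pos, div_lt_one (by linarith)]; exact hV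
  have hφ1 : 1 - 1 / V ≤ V - 1 := by
    have h1 : 1 - 1 / V = (V - 1) * (1 / V) := by
      have : V ≠ 0 := by linarith
      field_simp
    have h2 : 1 / V ≤ 1 := by linarith
    rw [h1]
    nlinarith
  set φ := 1 - 1 / V with hφ
  have h1 : Real.exp (W * φ) - 1 ≤ W * φ * Real.exp (W * φ) := by
    have h2 := Real.add_one_le_exp (-(W * φ))
    have h3 := mul_le_mul_of_nonneg_right h2 (Real.exp_pos (W * φ)).le
    rw [← Real.exp_add, neg_add_cancel, Real.exp_zero] at h3
    linarith
  have hκ0 : 0 ≤ W * (E - 1) := mul_nonneg hW.le (by linarith)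
  have h2 : W * φ < 1 - W * (E - 1) := by
    have h3 : W * φ ≤ W * (ρ - 1) := mul_le_mul_of_nonneg_left (by linarith) hW.le
    have h4 : 0 ≤ W * ((ρ - 1) * (E - 1)) :=
      mul_nonneg hW.le (mul_nonneg (by linarith) (by linarith))
    nlinarith
  have h3 : W * (E - 1) * Real.exp (W * φ) < 1 := by
    rcases eq_or_lt_of_le hκ0 with h4 | h4
    · rw [← h4]; simp
    · have h5 : Real.exp (W * φ) < Real.exp (1 - W * (E - 1)) := Real.exp_lt_exp.2 h2
      have h6 : W * (E - 1) ≤ Real.exp (W * (E - 1) - 1) := by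
        linarith [Real.add_one_le_exp (W * (E - 1) - 1)]
      calc W * (E - 1) * Real.exp (W * φ) < W * (E - 1) * Real.exp (1 - W * (E - 1)) :=
            mul_lt_mul_of_pos_left h5 h4
        _ ≤ Real.exp (W * (E - 1) - 1) * Real.exp (1 - W * (E - 1)) :=
            mul_le_mul_of_nonneg_right h6 (Real.exp_pos _).le
        _ = 1 := by rw [← Real.exp_add]; simp
  have h4 := mul_le_mul_of_nonneg_left h1 (show 0 ≤ E - 1 by linarith)
  have h5 := mul_lt_mul_of_pos_right h3 hφ0
  linarith

lemma NichGood.attract (G : NichGood m p a δ τd σd τ Δ Q α γ D P ζ am ap T)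
    (Sx : NichSol m p a δ τd σd τ T x) (Sy : NichSol m p a δ τd σd τ T y)
    {M μ : ℝ} (hM : 0 < M) (hμ : 0 < μ)
    (hγ : γ * Real.exp (-(am * Real.exp (-(D + P)) * M)) < 1)
    (hα : 1 < α * Real.exp (-(ap * Real.exp ζ * μ)))
    (hcond : ap * M * (M / μ * Real.exp (2 * D + P) - 1) < 1) :
    Tendsto (fun t => x t - y t) atTop (nhds 0) := by
  have hxM := G.upper Sx hM hγ
  have hyM := G.upper Sy hM hγ
  have hxμ := G.lower Sx hμ hα
  have hyμ := G.lower Sy hμ hα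
  have hD0 := G.D0
  have hP0 := G.P0
  obtain ⟨tm, htm1, htm2⟩ := (hyM.and hyμ).exists
  set A : Set ℝ := {c | 1 ≤ c ∧ ∀ᶠ t in atTop, x t ≤ c * y t ∧ y t ≤ c * x t} with hA
  have hmem : M / μ ∈ A := by
    refine ⟨by rw [one_le_div hμ]; linarith, ?_⟩
    filter_upwards [hxM, hyM, hxμ, hyμ] with t h1 h2 h3 h4
    have e : M / μ * μ = M := by field_simp
    have h5 : 0 ≤ M / μ := by positivity
    have h6 := mul_le_mul_of_nonneg_left h3 h5
    have h7 := mul_le_mul_of_nonneg_left h4 h5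
    exact ⟨by linarith, by linarith⟩
  have hne : A.Nonempty := ⟨_, hmem⟩
  have hbd : BddBelow A := ⟨1, fun c hc => hc.1⟩
  set V := sInf A with hVdef
  have hV1 : 1 ≤ V := le_csInf hne (fun c hc => hc.1)
  have hVρ : V ≤ M / μ := csInf_le hbd hmem
  have hpos : ∀ᶠ t in atTop, 0 < x t ∧ 0 < y t := by
    filter_upwards [hxμ, hyμ] with t h1 h2
    exact ⟨by linarith, by linarith⟩
  have hab : ∀ c > V, ∀ᶠ t in atTop, x t ≤ c * y t ∧ y t ≤ c * x t := by
    intro c hc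
    obtain ⟨d, hd, hdc⟩ := exists_lt_of_csInf_lt hne hc
    filter_upwards [hd.2, hpos] with t h1 h2
    have h3 := mul_le_mul_of_nonneg_right hdc.le h2.1.le
    have h4 := mul_le_mul_of_nonneg_right hdc.le h2.2.le
    exact ⟨by linarith, by linarith⟩
  have hVeq : V = 1 := by
    by_contra hne1
    have hV : 1 < V := lt_of_le_of_ne hV1 (Ne.symm hne1)
    have hc := nich_cond (W := ap * M) (mul_pos G.ap_pos hM)
      (Real.one_le_exp (show 0 ≤ 2 * D + P by linarith)) hV hVρ hcond
    obtain ⟨ε₁, hε₁, h1⟩ := G.contract Sx Sy hV hμ hyM hyμ hc hab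
    obtain ⟨ε₂, hε₂, h2⟩ := G.contract Sy Sx hV hμ hxM hxμ hc
      (fun c hc => (hab c hc).mono (fun t ht => ⟨ht.2, ht.1⟩))
    set c := max 1 (max (V - ε₁) (V - ε₂)) with hcdef
    have hcV : c < V := max_lt hV (max_lt (by linarith) (by linarith))
    have hcA : c ∈ A := by
      refine ⟨le_max_left _ _, ?_⟩
      filter_upwards [h1, h2, hpos] with t h1 h2 h3
      have e1 : V - ε₁ ≤ c := (le_max_left _ _).trans (le_max_right _ _)
      have e2 : V - ε₂ ≤ c := (le_max_right _ _).trans (le_max_right _ _)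
      have h4 := mul_le_mul_of_nonneg_right e1 h3.2.le
      have h5 := mul_le_mul_of_nonneg_right e2 h3.1.le
      exact ⟨by linarith, by linarith⟩
    have : V ≤ c := csInf_le hbd hcA
    linarith
  rw [Metric.tendsto_nhds]
  intro e he
  have hk : 0 < e / (2 * M) := by positivity
  filter_upwards [hab (1 + e / (2 * M)) (by linarith), hxM, hyM] with t h1 h2 h3
  rw [Real.dist_eq, sub_zero]
  have e1 : e / (2 * M) * M = e / 2 := by field_simp
  have h4 := mul_le_mul_of_nonneg_left h2 hk.le
  have h5 := mul_le_mul_of_nonneg_left h3 hk.le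
  rw [abs_lt]
  constructor <;> linarith

end core

/-! ### Connecting the abstract setting with the statement -/

lemma nich_ext_cont {f : ℝ → ℝ} (hf : ContinuousOn f (Ici 0)) :
    Continuous (fun t => f (max t 0)) :=
  hf.comp_continuous (by fun_prop) (fun t => le_max_right t 0)

lemma nich_prim_deriv {f : ℝ → ℝ} (hf : ContinuousOn f (Ici 0)) (t : ℝ) :
    HasDerivAt (fun t => ∫ s in (0:ℝ)..t, f (max s 0)) (f (max t 0)) t :=
  (nich_ext_cont hf).integral_hasStrictDerivAt 0 t |>.hasDerivAt

lemma nich_prim_sub {f : ℝ → ℝ} (hf : ContinuousOn f (Ici 0)) {s t : ℝ} (hs : 0 ≤ s)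
    (hst : s ≤ t) : ∫ u in s..t, f u
      = (∫ u in (0:ℝ)..t, f (max u 0)) - ∫ u in (0:ℝ)..s, f (max u 0) := by
  have hc := nich_ext_cont hf
  rw [intervalIntegral.integral_interval_sub_left (hc.intervalIntegrable _ _)
    (hc.intervalIntegrable _ _)]
  apply intervalIntegral.integral_congr
  intro u hu
  rw [uIcc_of_le hst] at hu
  simp only
  rw [max_eq_left (hs.trans hu.1)]

lemma nich_prim_mono {f : ℝ → ℝ} (hf : ContinuousOn f (Ici 0)) (hpos : ∀ t ≥ (0:ℝ), 0 < f t)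
    {s t : ℝ} (hst : s ≤ t) :
    (∫ u in (0:ℝ)..s, f (max u 0)) ≤ ∫ u in (0:ℝ)..t, f (max u 0) :=
  nich_mono_of_deriv (T := s) (fun t _ => nich_prim_deriv hf t)
    (fun t _ => (hpos _ (le_max_right t 0)).le) le_rfl hst

lemma nich_pos {m : ℕ} {p a : Fin m → ℝ → ℝ} {δ : ℝ → ℝ} {τd σd : Fin m → ℝ → ℝ} {τ : ℝ}
    (hA0 : HypA0 m p a δ τd σd) (hτ : IsMaxDelay m τd σd τ) {x : ℝ → ℝ}
    (hx : IsPosSol m p a δ τd σd τ x) : ∀ t ≥ 0, 0 < x t := by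
  obtain ⟨hp, ha, hδ, hd⟩ := hA0
  obtain ⟨hc, hini, hx0, hder⟩ := hx
  have hcx : ContinuousOn x (Ici 0) := fun t ht => (hder t ht).continuousWithinAt
  intro t1 ht1
  by_contra hcon
  push Not at hcon
  have hclosed : IsClosed (Icc 0 t1 ∩ x ⁻¹' (Iic 0)) :=
    (hcx.mono Icc_subset_Ici_self).preimage_isClosed_of_isClosed isClosed_Icc isClosed_Iic
  have hcomp : IsCompact (Icc 0 t1 ∩ x ⁻¹' (Iic 0)) :=
    isCompact_Icc.of_isClosed_subset hclosed inter_subset_left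
  obtain ⟨t0, ⟨ht0, ht0x⟩, hleast⟩ := hcomp.exists_isLeast ⟨t1, ⟨ht1, le_rfl⟩, hcon⟩
  have hx_t0 : x t0 ≤ 0 := ht0x
  have hposlt : ∀ t, 0 ≤ t → t < t0 → 0 < x t := by
    intro t h1 h2
    by_contra h3
    push Not at h3
    have := hleast (a := t) ⟨⟨h1, h2.le.trans ht0.2⟩, h3⟩
    linarith
  have hm : MonotoneOn (fun t => x t * Real.exp (∫ s in (0:ℝ)..t, δ (max s 0))) (Icc 0 t0) := by
    have hdX : ∀ t ∈ Ioo 0 t0,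
        HasDerivAt (fun t => x t * Real.exp (∫ s in (0:ℝ)..t, δ (max s 0)))
        (((∑ j, p j t * x (t - τd j t) * Real.exp (-(a j t * x (t - σd j t)))) - δ t * x t)
          * Real.exp (∫ s in (0:ℝ)..t, δ (max s 0))
          + x t * (Real.exp (∫ s in (0:ℝ)..t, δ (max s 0)) * δ (max t 0))) t := by
      intro t ht
      exact ((hder t ht.1.le).hasDerivAt (Ici_mem_nhds ht.1)).mul
        (nich_prim_deriv hδ.1 t).exp
    apply monotoneOn_of_deriv_nonneg (convex_Icc 0 t0)
    · apply ContinuousOn.mul (hcx.mono Icc_subset_Ici_self)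
      intro t _
      exact (nich_prim_deriv hδ.1 t).exp.continuousAt.continuousWithinAt
    · intro t ht
      rw [interior_Icc] at ht
      exact (hdX t ht).differentiableAt.differentiableWithinAt
    · intro t ht
      rw [interior_Icc] at ht
      rw [(hdX t ht).deriv, max_eq_left ht.1.le]
      have hN : 0 ≤ ∑ j, p j t * x (t - τd j t) * Real.exp (-(a j t * x (t - σd j t))) := by
        apply Finset.sum_nonneg
        intro j _
        have h1 := ((hp j).2 t ht.1.le).le
        have h2 : τd j t ≤ τ := hτ.1 ⟨j, t, ht.1.le, Or.inl rfl⟩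
        have h3 := ((hd j).2.2.1 t ht.1.le).1
        have h4 : 0 ≤ x (t - τd j t) := by
          rcases lt_or_ge (t - τd j t) 0 with h | h
          · exact hini _ ⟨by linarith [ht.1], h⟩
          · exact (hposlt _ h (by linarith [ht.2])).le
        positivity
      have := mul_nonneg hN (Real.exp_pos (∫ s in (0:ℝ)..t, δ (max s 0))).le
      linarith
  have h1 := hm ⟨le_rfl, ht0.1⟩ ⟨ht0.1, le_rfl⟩ ht0.1
  simp only [intervalIntegral.integral_same, Real.exp_zero, mul_one] at h1
  have h2 := mul_nonpos_of_nonpos_of_nonneg hx_t0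
    (Real.exp_pos (∫ s in (0:ℝ)..t0, δ (max s 0))).le
  linarith

lemma nich_limsup_nonneg {f : ℝ → ℝ} (h0 : ∀ᶠ t in atTop, 0 ≤ f t)
    (hb : IsBoundedUnder (· ≤ ·) atTop f) : 0 ≤ limsup f atTop := by
  by_contra h
  push Not at h
  obtain ⟨t, h1, h2⟩ := ((eventually_lt_of_limsup_lt h hb).and h0).exists
  linarith

lemma nich_A5 {am ap α γ D P ζ : ℝ} (ham : 0 < am) (hap : am ≤ ap) (hα : 1 < α) (hαγ : α ≤ γ)
    (hD : 0 ≤ D) (hP : 0 ≤ P) (hζ : 0 ≤ ζ)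
    (hA5 : (ap / am) * Real.log γ * Real.exp (2 * (D + P)) *
        ((ap * Real.log γ) / (am * Real.log α) * Real.exp (4 * D + 3 * P + ζ) - 1) < 1) :
    ap * (Real.log γ / am * Real.exp (D + P)) * ((Real.log γ / am * Real.exp (D + P)) /
      (Real.log α / ap * Real.exp (-ζ)) * Real.exp (2 * D + P) - 1) < 1 := by
  have hap0 : 0 < ap := by linarith
  have hlα : 0 < Real.log α := Real.log_pos hα
  have hlγ : 0 < Real.log γ := Real.log_pos (by linarith)
  have hll : Real.log α ≤ Real.log γ := Real.log_le_log (by linarith) hαγ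
  set R := (ap * Real.log γ) / (am * Real.log α) with hR
  set k := ap / am * Real.log γ with hk
  have hk0 : 0 < k := by positivity
  have hR1 : 1 ≤ R := by
    rw [hR, one_le_div (by positivity)]
    exact mul_le_mul hap hll hlα.le hap0.le
  have e1 : ap * (Real.log γ / am * Real.exp (D + P)) = k * Real.exp (D + P) := by
    rw [hk]; ring
  have e2 : (Real.log γ / am * Real.exp (D + P)) / (Real.log α / ap * Real.exp (-ζ))
      * Real.exp (2 * D + P) = R * Real.exp (3 * D + 2 * P + ζ) := by
    have : Real.exp (3 * D + 2 * P + ζ)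
        = Real.exp (D + P) * Real.exp ζ * Real.exp (2 * D + P) := by
      rw [← Real.exp_add, ← Real.exp_add]; ring_nf
    rw [this, Real.exp_neg, hR]
    field_simp
  rw [e1, e2]
  have h1 : Real.exp (3 * D + 2 * P + ζ) ≤ Real.exp (4 * D + 3 * P + ζ) :=
    Real.exp_le_exp.2 (by linarith)
  have h2 : 1 ≤ Real.exp (4 * D + 3 * P + ζ) := Real.one_le_exp (by linarith)
  have h3 : Real.exp (D + P) ≤ Real.exp (2 * (D + P)) := Real.exp_le_exp.2 (by linarith)
  have h4 : 0 ≤ R * Real.exp (4 * D + 3 * P + ζ) - 1 := by nlinarith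
  have h5 := mul_le_mul_of_nonneg_left h1 (show 0 ≤ R by linarith)
  calc k * Real.exp (D + P) * (R * Real.exp (3 * D + 2 * P + ζ) - 1)
      ≤ k * Real.exp (D + P) * (R * Real.exp (4 * D + 3 * P + ζ) - 1) :=
        mul_le_mul_of_nonneg_left (by linarith) (by positivity)
    _ ≤ k * Real.exp (2 * (D + P)) * (R * Real.exp (4 * D + 3 * P + ζ) - 1) :=
        mul_le_mul_of_nonneg_right (mul_le_mul_of_nonneg_left h3 hk0.le) h4
    _ < 1 := hA5

/-- Under (A0) to (A3) and (A5), equation (*) is globally attractive: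
any two positive solutions approach each other as `t → ∞`. -/
theorem global_attractivity_of_all_solutions
    (m : ℕ) (hm : 0 < m) (p a : Fin m → ℝ → ℝ) (δ : ℝ → ℝ)
    (τd σd : Fin m → ℝ → ℝ) (τ : ℝ)
    (hA0 : HypA0 m p a δ τd σd) (hτ : IsMaxDelay m τd σd τ)
    (hA1 : HypA1 m p δ) (hA2 : HypA2 m p τ) (hA3 : HypA3 δ)
    (aminus aplus : ℝ)
    (haminus : IsGLB {r : ℝ | ∃ j : Fin m, ∃ t : ℝ, 0 ≤ t ∧ r = a j t} aminus)
    (haplus : IsLUB {r : ℝ | ∃ j : Fin m, ∃ t : ℝ, 0 ≤ t ∧ r = a j t} aplus)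
    (α γ D P : ℝ)
    (hα : α = Filter.liminf (fun t => (∑ j, p j t) / δ t) Filter.atTop)
    (hγ : γ = Filter.limsup (fun t => (∑ j, p j t) / δ t) Filter.atTop)
    (hD : D = Filter.limsup (fun t => ∫ s in t - τ..t, δ s) Filter.atTop)
    (hP : P = Filter.limsup (fun t => ∫ s in t - τ..t, (∑ j, p j s)) Filter.atTop)
    (ζplus : ℝ)
    (hζ : IsGreatest {r : ℝ | ∃ j : Fin m,
        r = Filter.limsup (fun t => ∫ s in (t - σd j t)..t, δ s) Filter.atTop} ζplus)
    (hA5 : (aplus / aminus) * Real.log γ * Real.exp (2 * (D + P)) *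
        ((aplus * Real.log γ) / (aminus * Real.log α) *
          Real.exp (4 * D + 3 * P + ζplus) - 1) < 1) :
    ∀ x₁ x₂ : ℝ → ℝ, IsPosSol m p a δ τd σd τ x₁ → IsPosSol m p a δ τd σd τ x₂ →
      Filter.Tendsto (fun t => x₁ t - x₂ t) Filter.atTop (nhds 0) := by
  intro x₁ x₂ hx₁ hx₂
  have hpos₁ := nich_pos hA0 hτ hx₁
  have hpos₂ := nich_pos hA0 hτ hx₂
  obtain ⟨hp, ha, hδ, hd⟩ := hA0
  have hδc := hδ.1
  have hpc : ContinuousOn (fun t => ∑ j, p j t) (Ici 0) :=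
    continuousOn_finsetSum _ (fun j _ => (hp j).1)
  have hne : (Finset.univ : Finset (Fin m)).Nonempty := ⟨⟨0, hm⟩, Finset.mem_univ _⟩
  have hppos : ∀ t ≥ (0:ℝ), 0 < ∑ j, p j t := fun t ht =>
    Finset.sum_pos (fun j _ => (hp j).2 t ht) hne
  have hτle : ∀ t ≥ (0:ℝ), ∀ j, τd j t ≤ τ ∧ σd j t ≤ τ := fun t ht j =>
    ⟨hτ.1 ⟨j, t, ht, Or.inl rfl⟩, hτ.1 ⟨j, t, ht, Or.inr rfl⟩⟩
  have hτ0 : 0 ≤ τ := ((hd ⟨0, hm⟩).2.2.1 0 le_rfl).1.trans (hτle 0 le_rfl ⟨0, hm⟩).1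
  have haj : ∀ t ≥ (0:ℝ), ∀ j, aminus ≤ a j t ∧ a j t ≤ aplus := fun t ht j =>
    ⟨haminus.1 ⟨j, t, ht, rfl⟩, haplus.1 ⟨j, t, ht, rfl⟩⟩
  have ham : 0 < aminus := by
    have h : ∀ j, ∃ c : ℝ, 0 < c ∧ ∀ t ≥ (0:ℝ), c ≤ a j t := by
      intro j
      obtain ⟨c, C, hc, hcC⟩ := (ha j).2
      exact ⟨c, hc, fun t ht => (hcC t ht).1⟩
    choose c hc hca using h
    obtain ⟨j0, _, hj0⟩ := Finset.exists_min_image Finset.univ c hne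
    refine lt_of_lt_of_le (hc j0) (haminus.2 ?_)
    rintro r ⟨j, t, ht, rfl⟩
    exact (hj0 j (Finset.mem_univ _)).trans (hca j t ht)
  have hap : aminus ≤ aplus := (haj 0 le_rfl ⟨0, hm⟩).1.trans (haj 0 le_rfl ⟨0, hm⟩).2
  have hap0 : 0 < aplus := by linarith
  obtain ⟨hliminf, hbdd⟩ := hA1
  have hbdd2 : IsBoundedUnder (· ≥ ·) atTop (fun t => (∑ j, p j t) / δ t) := by
    refine ⟨0, ?_⟩
    rw [eventually_map]
    filter_upwards [eventually_ge_atTop 0] with t ht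
    exact (div_pos (hppos t ht) (hδ.2 t ht)).le
  have hα1 : 1 < α := by rw [hα]; exact hliminf
  have hαγ : α ≤ γ := by rw [hα, hγ]; exact liminf_le_limsup hbdd hbdd2
  have hpδ : ∀ᶠ t in atTop, δ t ≤ ∑ j, p j t := by
    filter_upwards [eventually_lt_of_lt_liminf hliminf hbdd2, eventually_ge_atTop 0] with t h1 h2
    rw [lt_div_iff₀ (hδ.2 t h2)] at h1
    linarith
  -- integrals
  set Δ : ℝ → ℝ := fun t => ∫ s in (0:ℝ)..t, δ (max s 0) with hΔdef
  set Q : ℝ → ℝ := fun t => ∫ s in (0:ℝ)..t, (∑ j, p j (max s 0)) with hQdef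
  have hΔmono : ∀ s t, s ≤ t → Δ s ≤ Δ t := fun s t hst => nich_prim_mono hδc hδ.2 hst
  have hQmono : ∀ s t, s ≤ t → Q s ≤ Q t := fun s t hst => nich_prim_mono hpc hppos hst
  have hΔsub : ∀ s t, 0 ≤ s → s ≤ t → ∫ u in s..t, δ u = Δ t - Δ s :=
    fun s t hs hst => nich_prim_sub hδc hs hst
  have hQsub : ∀ s t, 0 ≤ s → s ≤ t → ∫ u in s..t, (∑ j, p j u) = Q t - Q s :=
    fun s t hs hst => nich_prim_sub hpc hs hst
  have hΔder : ∀ t ≥ (0:ℝ), HasDerivAt Δ (δ t) t := by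
    intro t ht
    have := nich_prim_deriv hδc t
    rwa [max_eq_left ht] at this
  have hQder : ∀ t ≥ (0:ℝ), HasDerivAt Q (∑ j, p j t) t := by
    intro t ht
    have := nich_prim_deriv hpc t
    rwa [max_eq_left ht] at this
  have hPnn : ∀ᶠ t in atTop, 0 ≤ ∫ s in t - τ..t, (∑ j, p j s) := by
    filter_upwards [eventually_ge_atTop τ] with t ht
    rw [hQsub (t - τ) t (by linarith) (by linarith)]
    linarith [hQmono (t - τ) t (by linarith)]
  have hDnn : ∀ᶠ t in atTop, 0 ≤ ∫ s in t - τ..t, δ s := by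
    filter_upwards [eventually_ge_atTop τ] with t ht
    rw [hΔsub (t - τ) t (by linarith) (by linarith)]
    linarith [hΔmono (t - τ) t (by linarith)]
  have hP0 : 0 ≤ P := by rw [hP]; exact nich_limsup_nonneg hPnn hA2
  have hDP : ∀ᶠ t in atTop, ∫ s in t - τ..t, δ s ≤ ∫ s in t - τ..t, (∑ j, p j s) := by
    obtain ⟨N, hN⟩ := eventually_atTop.1 hpδ
    filter_upwards [eventually_ge_atTop (max (N + τ) τ)] with t ht
    have ht1 : N + τ ≤ t := (le_max_left _ _).trans ht
    have ht2 : τ ≤ t := (le_max_right _ _).trans ht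
    have hsub : Icc (t - τ) t ⊆ Ici 0 := fun u hu => by
      have := hu.1
      simp only [mem_Ici]
      linarith
    apply intervalIntegral.integral_mono_on (by linarith)
    · apply ContinuousOn.intervalIntegrable
      rw [uIcc_of_le (by linarith)]
      exact hδc.mono hsub
    · apply ContinuousOn.intervalIntegrable
      rw [uIcc_of_le (by linarith)]
      exact hpc.mono hsub
    · intro u hu
      exact hN u (by linarith [hu.1])
  have hDb : IsBoundedUnder (· ≤ ·) atTop (fun t => ∫ s in t - τ..t, δ s) := by
    obtain ⟨b, hb⟩ := hA2
    rw [eventually_map] at hb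
    refine ⟨b, ?_⟩
    rw [eventually_map]
    filter_upwards [hDP, hb] with t h1 h2
    exact h1.trans h2
  have hD0 : 0 ≤ D := by rw [hD]; exact nich_limsup_nonneg hDnn hDb
  have hζb : ∀ j, IsBoundedUnder (· ≤ ·) atTop (fun t => ∫ s in (t - σd j t)..t, δ s) := by
    intro j
    obtain ⟨b, hb⟩ := hDb
    rw [eventually_map] at hb
    refine ⟨b, ?_⟩
    rw [eventually_map]
    filter_upwards [hb, eventually_ge_atTop τ] with t h1 h2
    have h3 := (hτle t (by linarith) j).2
    have h4 := ((hd j).2.2.1 t (by linarith)).2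
    rw [hΔsub (t - τ) t (by linarith) (by linarith)] at h1
    rw [hΔsub (t - σd j t) t (by linarith) (by linarith)]
    linarith [hΔmono (t - τ) (t - σd j t) (by linarith)]
  have hζ0 : 0 ≤ ζplus := by
    obtain ⟨j, hj⟩ := hζ.1
    rw [hj]
    refine nich_limsup_nonneg ?_ (hζb j)
    filter_upwards [eventually_ge_atTop τ] with t ht
    have h3 := (hτle t (by linarith) j).2
    have h4 := ((hd j).2.2.1 t (by linarith)).2
    rw [hΔsub (t - σd j t) t (by linarith) (by linarith)]
    linarith [hΔmono (t - σd j t) t (by linarith)]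
  have hmain := nich_A5 ham hap hα1 hαγ hD0 hP0 hζ0 hA5
  -- choice of the margin
  have hlα : 0 < Real.log α := Real.log_pos hα1
  have cM : ContinuousAt (fun ε : ℝ =>
      Real.log (γ + ε) / aminus * Real.exp (D + ε + (P + ε)) + ε) 0 := by
    have h1 : ContinuousAt (fun ε : ℝ => Real.log (γ + ε)) 0 := by
      apply ContinuousAt.log (by fun_prop)
      have : 0 < γ := by linarith
      simpa using this.ne'
    fun_prop
  have cμ : ContinuousAt (fun ε : ℝ =>
      Real.log (α - ε) / aplus * Real.exp (-(ζplus + ε)) - ε) 0 := by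
    have h1 : ContinuousAt (fun ε : ℝ => Real.log (α - ε)) 0 := by
      apply ContinuousAt.log (by fun_prop)
      have : 0 < α := by linarith
      simpa using this.ne'
    fun_prop
  have μ00 : 0 < Real.log (α - 0) / aplus * Real.exp (-(ζplus + 0)) - 0 := by
    simp only [sub_zero]
    positivity
  have hev1 := cμ.eventually_const_lt (u := 0) μ00
  have cA : ContinuousAt (fun ε : ℝ =>
      aplus * (Real.log (γ + ε) / aminus * Real.exp (D + ε + (P + ε)) + ε) *
      ((Real.log (γ + ε) / aminus * Real.exp (D + ε + (P + ε)) + ε) /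
        (Real.log (α - ε) / aplus * Real.exp (-(ζplus + ε)) - ε)
        * Real.exp (2 * (D + ε) + (P + ε)) - 1)) 0 := by
    have h1 := cM.div cμ μ00.ne'
    exact (continuousAt_const.mul cM).mul ((h1.mul (by fun_prop)).sub continuousAt_const)
  have hev2 := cA.eventually_lt_const (u := 1) (by simpa using hmain)
  have hev3 : ∀ᶠ ε : ℝ in nhds 0, ε < α - 1 := eventually_lt_nhds (by linarith)
  obtain ⟨ε, ⟨hεμ, hεA, hεα⟩, hε'⟩ :=
    (((hev1.and (hev2.and hev3)).filter_mono nhdsWithin_le_nhds).and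
        (self_mem_nhdsWithin (s := Ioi (0:ℝ)))).exists
  have hε : 0 < ε := hε'
  set M := Real.log (γ + ε) / aminus * Real.exp (D + ε + (P + ε)) + ε with hMdef
  set μ := Real.log (α - ε) / aplus * Real.exp (-(ζplus + ε)) - ε with hμdef
  have hγ1 : 1 < γ + ε := by linarith
  have hα2 : 1 < α - ε := by linarith
  have hM0 : 0 < M := by
    have := Real.log_pos hγ1
    positivity
  have hMc : (γ + ε) * Real.exp (-(aminus * Real.exp (-(D + ε + (P + ε))) * M)) < 1 := by
    have e : aminus * Real.exp (-(D + ε + (P + ε))) * M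
        = Real.log (γ + ε) + aminus * Real.exp (-(D + ε + (P + ε))) * ε := by
      rw [hMdef, Real.exp_neg]
      field_simp
    have h1 : 0 < aminus * Real.exp (-(D + ε + (P + ε))) * ε := by positivity
    have h2 : Real.exp (-(aminus * Real.exp (-(D + ε + (P + ε))) * M))
        < Real.exp (-Real.log (γ + ε)) := Real.exp_lt_exp.2 (by rw [e]; linarith)
    rw [Real.exp_neg (Real.log (γ + ε)), Real.exp_log (by linarith)] at h2
    calc _ < (γ + ε) * (γ + ε)⁻¹ := mul_lt_mul_of_pos_left h2 (by linarith)
      _ = 1 := mul_inv_cancel₀ (by linarith)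
  have hμc : 1 < (α - ε) * Real.exp (-(aplus * Real.exp (ζplus + ε) * μ)) := by
    have e : aplus * Real.exp (ζplus + ε) * μ
        = Real.log (α - ε) - aplus * Real.exp (ζplus + ε) * ε := by
      rw [hμdef, Real.exp_neg]
      field_simp
    have h1 : 0 < aplus * Real.exp (ζplus + ε) * ε := by positivity
    have h2 : Real.exp (-Real.log (α - ε))
        < Real.exp (-(aplus * Real.exp (ζplus + ε) * μ)) :=
      Real.exp_lt_exp.2 (by rw [e]; linarith)
    rw [Real.exp_neg (Real.log (α - ε)), Real.exp_log (by linarith)] at h2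
    calc 1 = (α - ε) * (α - ε)⁻¹ := (mul_inv_cancel₀ (by linarith)).symm
      _ < _ := mul_lt_mul_of_pos_left h2 (by linarith)
  -- eventual bounds
  have b1 : ∀ᶠ t in atTop, α - ε < (∑ j, p j t) / δ t :=
    eventually_lt_of_lt_liminf (by rw [← hα]; linarith) hbdd2
  have b2 : ∀ᶠ t in atTop, (∑ j, p j t) / δ t < γ + ε :=
    eventually_lt_of_limsup_lt (by rw [← hγ]; linarith) hbdd
  have b3 : ∀ᶠ t in atTop, ∫ s in t - τ..t, δ s < D + ε :=
    eventually_lt_of_limsup_lt (by rw [← hD]; linarith) hDb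
  have b4 : ∀ᶠ t in atTop, ∫ s in t - τ..t, (∑ j, p j s) < P + ε :=
    eventually_lt_of_limsup_lt (by rw [← hP]; linarith) hA2
  have b5 : ∀ᶠ t in atTop, ∀ j, ∫ s in (t - σd j t)..t, δ s < ζplus + ε := by
    rw [eventually_all]
    intro j
    have := hζ.2 ⟨j, rfl⟩
    exact eventually_lt_of_limsup_lt (by linarith) (hζb j)
  obtain ⟨T, hT⟩ := eventually_atTop.1 ((b1.and b2).and ((b3.and b4).and
    (b5.and (eventually_ge_atTop (τ + 1)))))
  have hTτ : ∀ t ≥ T, τ + 1 ≤ t := fun t ht => (hT t ht).2.2.2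
  have hT1 := hTτ T le_rfl
  have G : NichGood m p a δ τd σd τ Δ Q (α - ε) (γ + ε) (D + ε) (P + ε) (ζplus + ε)
      aminus aplus T :=
    { hτ := hτ0
      am_pos := ham
      ap_pos := hap0
      one_lt := hα2
      γ_pos := by linarith
      D0 := by linarith
      P0 := by linarith
      p_pos := fun t ht j => (hp j).2 t (by linarith)
      δ_pos := fun t ht => hδ.2 t (by linarith)
      low := fun t ht => by
        have h1 := (hT t ht).1.1
        rw [lt_div_iff₀ (hδ.2 t (by linarith))] at h1
        exact h1.le
      up := fun t ht => by
        have h1 := (hT t ht).1.2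
        rw [div_lt_iff₀ (hδ.2 t (by linarith))] at h1
        exact h1.le
      dΔ := fun t ht => hΔder t (by linarith)
      dQ := fun t ht => hQder t (by linarith)
      monΔ := fun s t _ hst => hΔmono s t hst
      monQ := fun s t _ hst => hQmono s t hst
      bD := fun t ht s hs _ => by
        have h1 := (hT t ht).2.1.1
        rw [hΔsub (t - τ) t (by linarith) (by linarith)] at h1
        linarith [hΔmono (t - τ) s hs]
      bP := fun t ht s hs _ => by
        have h1 := (hT t ht).2.1.2
        rw [hQsub (t - τ) t (by linarith) (by linarith)] at h1
        linarith [hQmono (t - τ) s hs]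
      bζ := fun t ht j => by
        have h1 := (hT t ht).2.2.1 j
        have h3 := (hτle t (by linarith) j).2
        have h4 := ((hd j).2.2.1 t (by linarith)).2
        rw [hΔsub (t - σd j t) t (by linarith) (by linarith)] at h1
        exact h1.le
      ha := fun t ht j => haj t (by linarith) j
      hτd := fun t ht j => ⟨((hd j).2.2.1 t (by linarith)).1, (hτle t (by linarith) j).1⟩
      hσd := fun t ht j => ⟨((hd j).2.2.1 t (by linarith)).2, (hτle t (by linarith) j).2⟩
      htop := by
        refine hA3.congr' ?_
        filter_upwards [eventually_ge_atTop 0] with t ht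
        rw [hΔsub 0 t le_rfl ht]
        simp [hΔdef] }
  have sol : ∀ x, IsPosSol m p a δ τd σd τ x → (∀ t ≥ 0, 0 < x t) →
      NichSol m p a δ τd σd τ T x := fun x hx hpos =>
    { pos := fun t ht => hpos t (by linarith)
      der := fun t ht => (hx.2.2.2 t (by linarith)).hasDerivAt
        (Ici_mem_nhds (by linarith)) }
  exact G.attract (sol x₁ hx₁ hpos₁) (sol x₂ hx₂ hpos₂) hM0 hεμ hMc hμc hεA
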